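/- Let A be a bireversible automaton whose automaton group G_A is infinite. Then π₁(Δ_A) is not ⟨S⟩-separable and not ⟨X⟩-separable: there exists γ ∈ π₁(Δ_A) with γ ∉ ⟨S⟩ such that γ belongs to every finite-index subgroup of π₁(Δ_A) containing ⟨S⟩, and there exists δ ∈ π₁(Δ_A) with δ ∉ ⟨X⟩ such that δ belongs to every finite-index subgroup of π₁(Δ_A) containing ⟨X⟩. -/

import Mathlib

/-- A Mealy automaton with state set `S` and alphabet `X`:
`λ(s,x) = (o s x, t s x)`. -/
structure Mealy (S X : Type) where
  o : S → X → X
  t : S → X → S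

namespace Mealy

variable {S X : Type}

/-- Bireversibility of a Mealy automaton. -/
def Bireversible (M : Mealy S X) : Prop :=
  (∀ s, Function.Bijective (M.o s)) ∧
  (∀ x, Function.Bijective (fun s => M.t s x)) ∧
  Function.Bijective (fun p : S × X => (M.o p.1 p.2, M.t p.1 p.2))

/-- The action of a state on words over the alphabet. -/
def actWord (M : Mealy S X) : S → List X → List X
  | _, [] => []
  | s, x :: w => M.o s x :: M.actWord (M.t s x) w

/-- The dual action of a letter on words over the states. -/
def dualActWord (M : Mealy S X) : X → List S → List S
  | _, [] => []
  | x, s :: w => M.t s x :: M.dualActWord (M.o s x) w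

/-- The relators `s x (t s x)⁻¹ (o s x)⁻¹` of the square-complex group. -/
def rels (M : Mealy S X) : Set (FreeGroup (S ⊕ X)) :=
  ⋃ (s : S) (x : X),
    {FreeGroup.of (Sum.inl s) * FreeGroup.of (Sum.inr x) *
      (FreeGroup.of (Sum.inl (M.t s x)))⁻¹ * (FreeGroup.of (Sum.inr (M.o s x)))⁻¹}

/-- The fundamental group `π₁(Δ_A)` of the square complex of the automaton. -/
abbrev Pi1 (M : Mealy S X) := PresentedGroup M.rels

/-- The image of a state in `π₁(Δ_A)`. -/
def genS (M : Mealy S X) (s : S) : M.Pi1 := PresentedGroup.of (Sum.inl s)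

/-- The image of a letter in `π₁(Δ_A)`. -/
def genX (M : Mealy S X) (x : X) : M.Pi1 := PresentedGroup.of (Sum.inr x)

/-- The subgroup `⟨S⟩` of `π₁(Δ_A)`. -/
def subS (M : Mealy S X) : Subgroup M.Pi1 := Subgroup.closure (Set.range M.genS)

/-- The subgroup `⟨X⟩` of `π₁(Δ_A)`. -/
def subX (M : Mealy S X) : Subgroup M.Pi1 := Subgroup.closure (Set.range M.genX)

/-- The automaton group `G_A`: the subgroup of `Perm (List X)` generated by the
permutations `σ_s` defined by the states. -/
def autGroup (M : Mealy S X) : Subgroup (Equiv.Perm (List X)) :=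
  Subgroup.closure {σ : Equiv.Perm (List X) | ∃ s, ⇑σ = M.actWord s}

/-- The dual automaton group `G_{∂A}`. -/
def dualAutGroup (M : Mealy S X) : Subgroup (Equiv.Perm (List S)) :=
  Subgroup.closure {τ : Equiv.Perm (List S) | ∃ x, ⇑τ = M.dualActWord x}

end Mealy

namespace FreeGroup

lemma induction_on_left {α : Type*} {C : FreeGroup α → Prop} (g : FreeGroup α) (one : C 1)
    (of_mul : ∀ x g, C g → C (of x * g)) (inv_of_mul : ∀ x g, C g → C ((of x)⁻¹ * g)) : C g := by
  have key : ∀ g, ∀ h, C h → C (g * h) := by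
    intro g
    induction g using FreeGroup.induction_on with
    | C1 => simp
    | of x => exact of_mul x
    | inv_of x _ => exact inv_of_mul x
    | mul x y hx hy => intro h hh; rw [mul_assoc]; exact hx _ (hy _ hh)
  simpa using key g 1 one

lemma injective_prod_map_of {α : Type*} :
    Function.Injective fun w : List α => (w.map FreeGroup.of).prod := by
  classical
  have hmk : ∀ w : List α, (w.map FreeGroup.of).prod = FreeGroup.mk (w.map fun x => (x, true)) := by
    intro w
    induction w with
    | nil => rfl
    | cons x w ih => simp [ih, FreeGroup.of, FreeGroup.mul_mk]
  have hred : ∀ w : List α, FreeGroup.IsReduced (w.map fun x => (x, true)) := by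
    intro w
    induction w with
    | nil => exact FreeGroup.IsReduced.nil
    | cons x w ih =>
      cases w with
      | nil => exact FreeGroup.IsReduced.singleton
      | cons y w => exact FreeGroup.isReduced_cons_cons.2 ⟨fun _ => rfl, ih⟩
  intro w w' h
  have h' := congrArg FreeGroup.toWord ((hmk w).symm.trans (h.trans (hmk w')))
  rw [FreeGroup.toWord_mk, FreeGroup.toWord_mk, (hred w).reduce_eq, (hred w').reduce_eq] at h'
  exact List.map_injective_iff.2 (fun _ _ e => congrArg Prod.fst e) h'

end FreeGroup

namespace Subgroup

variable {G : Type*} [Group G]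

/-- The elements of `H` form a closed set for the profinite topology of the ambient group. -/
def IsSeparable (H : Subgroup G) : Prop :=
  ∀ g, g ∉ H → ∃ K : Subgroup G, K.FiniteIndex ∧ H ≤ K ∧ g ∉ K

lemma IsSeparable.exists_finiteIndex_of_finite {H : Subgroup G} (hH : H.IsSeparable)
    {D : Set G} (hD : D.Finite) :
    ∃ K : Subgroup G, K.FiniteIndex ∧ H ≤ K ∧ ∀ g ∈ D, g ∈ K → g ∈ H := by
  induction D, hD using Set.Finite.induction_on with
  | empty => exact ⟨⊤, inferInstance, le_top, by simp⟩
  | @insert a D _ _ ih =>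
    obtain ⟨K, hK, hHK, hD⟩ := ih
    by_cases ha : a ∈ H
    · refine ⟨K, hK, hHK, ?_⟩
      rintro g (rfl | hg) hgK
      exacts [ha, hD g hg hgK]
    · obtain ⟨L, hL, hHL, haL⟩ := hH a ha
      refine ⟨K ⊓ L, inferInstance, le_inf hHK hHL, ?_⟩
      rintro g (rfl | hg) hgK
      exacts [absurd hgK.2 haL, hD g hg hgK.1]

/-- A separable subgroup with finite orbits on the cosets of a symmetric finite set which together
with it generates the group is virtually normal. -/
lemma IsSeparable.exists_inf_le_normalCore {H : Subgroup G} (hH : H.IsSeparable)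
    {B : Set G} (hB : B.Finite) (hinv : ∀ b ∈ B, b⁻¹ ∈ B)
    (horb : ∀ h ∈ H, ∀ b ∈ B, ∃ c ∈ B, c⁻¹ * (h * b) ∈ H)
    (hgen : closure ((H : Set G) ∪ B) = ⊤) :
    ∃ N : Subgroup G, N.FiniteIndex ∧ N ⊓ H ≤ H.normalCore := by
  obtain ⟨K, hK, hHK, hsep⟩ := hH.exists_finiteIndex_of_finite
    (hB.image2 (fun c b => c⁻¹ * b) hB)
  refine ⟨K.normalCore, inferInstance, ?_⟩
  have hconj : ∀ b ∈ B, ∀ n ∈ K.normalCore ⊓ H, b⁻¹ * n * b ∈ K.normalCore ⊓ H := by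
    rintro b hb n ⟨hnK, hnH⟩
    obtain ⟨c, hc, hcb⟩ := horb n hnH b hb
    have hN : b⁻¹ * n * b ∈ K.normalCore := by
      simpa using (inferInstance : K.normalCore.Normal).conj_mem n hnK b⁻¹
    have hcbK : c⁻¹ * b ∈ K := by
      have := K.mul_mem (hHK hcb) (K.inv_mem (K.normalCore_le hN))
      rwa [show c⁻¹ * (n * b) * (b⁻¹ * n * b)⁻¹ = c⁻¹ * b by group] at this
    have hcbH : c⁻¹ * b ∈ H := hsep _ ⟨c, hc, b, hb, rfl⟩ hcbK
    refine ⟨hN, ?_⟩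
    have := H.mul_mem (H.inv_mem hcbH) hcb
    rwa [show (c⁻¹ * b)⁻¹ * (c⁻¹ * (n * b)) = b⁻¹ * n * b by group] at this
  have hconjH : ∀ b ∈ H, ∀ n ∈ K.normalCore ⊓ H, b⁻¹ * n * b ∈ K.normalCore ⊓ H := by
    rintro b hb n ⟨hnK, hnH⟩
    exact ⟨by simpa using (inferInstance : K.normalCore.Normal).conj_mem n hnK b⁻¹,
      H.mul_mem (H.mul_mem (H.inv_mem hb) hnH) hb⟩
  have hall : ∀ g : G, ∀ n ∈ K.normalCore ⊓ H, g⁻¹ * n * g ∈ K.normalCore ⊓ H := by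
    intro g
    have hg : g ∈ closure ((H : Set G) ∪ B) := hgen ▸ mem_top g
    induction hg using closure_induction'' with
    | mem x hx => exact hx.elim (hconjH x) (hconj x)
    | inv_mem x hx =>
      exact hx.elim (fun h => hconjH _ (H.inv_mem h)) (fun h => hconj _ (hinv x h))
    | one => simp
    | mul x y _ _ hx hy =>
      intro n hn
      have := hy _ (hx n hn)
      rwa [show y⁻¹ * (x⁻¹ * n * x) * y = (x * y)⁻¹ * n * (x * y) by group] at this
  intro n hn g
  simpa using (hall g⁻¹ n hn).2

end Subgroup

namespace Mealy

/-- The dual automaton, exchanging states and letters. -/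
def dual {S X : Type} (M : Mealy S X) : Mealy X S where
  o x s := M.t s x
  t x s := M.o s x

lemma Bireversible.dual {S X : Type} {M : Mealy S X} (hb : M.Bireversible) :
    M.dual.Bireversible :=
  ⟨hb.2.1, hb.1, (Equiv.prodComm X S).bijective.comp
    (hb.2.2.comp (Equiv.prodComm X S).bijective)⟩

/-- The action of a word of states (first state first) on words. -/
def wordAct {S X : Type} (M : Mealy S X) : List S → List X → List X
  | [], w => w
  | s :: u, w => M.wordAct u (M.actWord s w)

lemma wordAct_append {S X : Type} (M : Mealy S X) (u v : List S) (w : List X) :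
    M.wordAct (u ++ v) w = M.wordAct v (M.wordAct u w) := by
  induction u generalizing w with
  | nil => rfl
  | cons s u ih => exact ih _

lemma wordAct_nil {S X : Type} (M : Mealy S X) (u : List S) : M.wordAct u [] = [] := by
  induction u with
  | nil => rfl
  | cons s u ih => exact ih

/-- The action of a word of states on a letter. -/
def letterAct {S X : Type} (M : Mealy S X) : List S → X → X
  | [], x => x
  | s :: u, x => M.letterAct u (M.o s x)

lemma wordAct_cons {S X : Type} (M : Mealy S X) (u : List S) (x : X) (w : List X) :
    M.wordAct u (x :: w) = M.letterAct u x :: M.wordAct (M.dual.actWord x u) w := by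
  induction u generalizing x w with
  | nil => rfl
  | cons s u ih => exact ih _ _

lemma wordAct_eq_of_letterAct_eq {S X : Type} (M : Mealy S X) (w : List X) (u u' : List S)
    (h : ∀ v, M.letterAct (M.dual.wordAct v u) = M.letterAct (M.dual.wordAct v u')) :
    M.wordAct u w = M.wordAct u' w := by
  induction w generalizing u u' with
  | nil => rw [wordAct_nil, wordAct_nil]
  | cons x w ih =>
    rw [wordAct_cons, wordAct_cons, ih _ _ fun v => h (x :: v)]
    exact congrArg (· :: _) (congrFun (h []) x)

/-- If the dual automaton generates a finite semigroup then so does the automaton. -/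
lemma finite_range_wordAct_of_dual {S X : Type} [Finite X] (M : Mealy S X)
    (h : (Set.range M.dual.wordAct).Finite) : (Set.range M.wordAct).Finite := by
  have := h.to_subtype
  let F : List S → Set.range M.dual.wordAct → X → X := fun u d => M.letterAct (d.1 u)
  refine Set.Finite.of_surjOn (s := Set.range F) (fun f => M.wordAct (Function.invFun F f)) ?_
    (Set.toFinite _)
  rintro _ ⟨u, rfl⟩
  refine ⟨F u, ⟨u, rfl⟩, funext fun w => M.wordAct_eq_of_letterAct_eq w _ _ fun v => ?_⟩
  exact congrFun (Function.invFun_eq (f := F) ⟨u, rfl⟩) ⟨_, v, rfl⟩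

lemma finite_autGroup {S X : Type} (M : Mealy S X) (h : (Set.range M.wordAct).Finite) :
    Finite M.autGroup := by
  set T : Set (Equiv.Perm (List X)) := {σ | ∃ s, ⇑σ = M.actWord s}
  have hmem : ∀ σ ∈ Submonoid.closure T, ⇑σ ∈ Set.range M.wordAct := by
    intro σ hσ
    induction hσ using Submonoid.closure_induction with
    | mem σ hσ => obtain ⟨s, hs⟩ := hσ; exact ⟨[s], hs.symm⟩
    | one => exact ⟨[], rfl⟩
    | mul σ τ _ _ hσ hτ =>
      obtain ⟨u, hu⟩ := hσ
      obtain ⟨v, hv⟩ := hτ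
      refine ⟨v ++ u, funext fun w => ?_⟩
      rw [wordAct_append, hu, hv, Equiv.Perm.mul_apply]
  have hfin : (Submonoid.closure T : Set (Equiv.Perm (List X))).Finite :=
    Set.Finite.of_finite_image (f := fun σ : Equiv.Perm (List X) => (σ : List X → List X))
      (h.subset (Set.image_subset_iff.2 hmem)) DFunLike.coe_injective.injOn
  have hord : ∀ σ ∈ T, IsOfFinOrder σ := fun σ hσ => finite_powers.1 <|
    hfin.subset (Submonoid.powers_le.2 (Submonoid.subset_closure hσ))
  have hcoe : (M.autGroup : Set (Equiv.Perm (List X))) = Submonoid.closure T := by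
    rw [← Subgroup.closure_toSubmonoid_of_isOfFinOrder hord]
    rfl
  exact (hcoe ▸ hfin).to_subtype

/-- A family of self-maps of the free group on the alphabet obeying the recursion of the
automaton. -/
structure IsFreeAction {S X : Type} (M : Mealy S X) (A : S → FreeGroup X → FreeGroup X) :
    Prop where
  one : ∀ s, A s 1 = 1
  of_mul : ∀ s x g, A s (.of x * g) = .of (M.o s x) * A (M.t s x) g

lemma exists_isFreeAction {S X : Type} (M : Mealy S X)
    (ht : ∀ x, Function.Bijective fun s => M.t s x) : ∃ A, M.IsFreeAction A := by
  let e : X → Equiv.Perm (S × FreeGroup X) := fun x =>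
    Equiv.ofBijective (fun p => (M.t p.1 x, p.2 * .of (M.o p.1 x))) <| by
      constructor
      · rintro ⟨s, g⟩ ⟨s', g'⟩ h
        obtain rfl : s = s' := (ht x).1 (congrArg Prod.fst h)
        simpa using h
      · rintro ⟨s, g⟩
        obtain ⟨s', rfl⟩ := (ht x).2 s
        exact ⟨(s', g * (.of (M.o s' x))⁻¹), by simp⟩
  let θ : FreeGroup X →* (Equiv.Perm (S × FreeGroup X))ᵐᵒᵖ :=
    FreeGroup.lift fun x => MulOpposite.op (e x)
  have he : ∀ x s g, (θ (.of x)).unop (s, g) = (M.t s x, g * .of (M.o s x)) := by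
    intro x s g
    simp only [θ, FreeGroup.lift_apply_of]
    rfl
  have hmul : ∀ w w' p, (θ (w * w')).unop p = (θ w').unop ((θ w).unop p) := by
    intro w w' p
    simp
  have hequiv : ∀ w s h g, (θ w).unop (s, h * g) =
      (((θ w).unop (s, g)).1, h * ((θ w).unop (s, g)).2) := by
    intro w
    induction w using FreeGroup.induction_on_left with
    | one => simp
    | of_mul x w ih =>
      intro s h g
      rw [hmul, hmul, he, he, mul_assoc, ih]
    | inv_of_mul x w ih =>
      intro s h g
      have hinv : ∀ s g, ∃ s', M.t s' x = s ∧
          (θ (.of x)⁻¹).unop (s, g) = (s', g * (.of (M.o s' x))⁻¹) := by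
        intro s g
        obtain ⟨s', rfl⟩ := (ht x).2 s
        refine ⟨s', rfl, ?_⟩
        rw [map_inv, MulOpposite.unop_inv, Equiv.Perm.inv_eq_iff_eq, he]
        simp
      obtain ⟨s₁, h₁, e₁⟩ := hinv s (h * g)
      obtain ⟨s₂, h₂, e₂⟩ := hinv s g
      obtain rfl : s₁ = s₂ := (ht x).1 (h₁.trans h₂.symm)
      rw [hmul, hmul, e₁, e₂, mul_assoc, ih]
  refine ⟨fun s w => ((θ w).unop (s, 1)).2, fun s => by simp, fun s x g => ?_⟩
  have := hequiv g (M.t s x) (.of (M.o s x)) 1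
  rw [mul_one] at this
  simp only [hmul, he, one_mul, this]

lemma IsFreeAction.inv_of_mul {S X : Type} {M : Mealy S X} {A : S → FreeGroup X → FreeGroup X}
    (hA : M.IsFreeAction A) (s : S) (x : X) (g : FreeGroup X) :
    A (M.t s x) ((.of x)⁻¹ * g) = (.of (M.o s x))⁻¹ * A s g := by
  rw [eq_inv_mul_iff_mul_eq, ← hA.of_mul, mul_inv_cancel_left]

lemma IsFreeAction.leftInverse {S X : Type} {M M' : Mealy S X}
    {A A' : S → FreeGroup X → FreeGroup X} (hA : M.IsFreeAction A) (hA' : M'.IsFreeAction A')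
    (ht : ∀ x, Function.Bijective fun s => M.t s x)
    (ho : ∀ s x, M'.o s (M.o s x) = x) (ht' : ∀ s x, M'.t s (M.o s x) = M.t s x) (s : S) :
    Function.LeftInverse (A' s) (A s) := by
  intro g
  induction g using FreeGroup.induction_on_left generalizing s with
  | one => rw [hA.one, hA'.one]
  | of_mul x g ih => rw [hA.of_mul, hA'.of_mul, ho, ht', ih]
  | inv_of_mul x g ih =>
    obtain ⟨s, rfl⟩ := (ht x).2 s
    have := hA'.inv_of_mul s (M.o s x) (A s g)
    rw [ho, ht'] at this
    rw [hA.inv_of_mul, this, ih]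

/-- The states of a bireversible automaton act by permutations on the free group on the
alphabet. -/
lemma Bireversible.exists_perm {S X : Type} {M : Mealy S X} (hb : M.Bireversible) :
    ∃ A : S → Equiv.Perm (FreeGroup X), M.IsFreeAction fun s => A s := by
  obtain ⟨ho, ht, hl⟩ := hb
  let f : S → X ≃ X := fun s => Equiv.ofBijective _ (ho s)
  have hf : ∀ s x, M.o s x = f s x := fun _ _ => rfl
  let M' : Mealy S X := ⟨fun s => (f s).symm, fun s y => M.t s ((f s).symm y)⟩
  have ht' : ∀ y, Function.Bijective fun s => M'.t s y := by
    intro y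
    constructor
    · intro s s' h
      refine congrArg Prod.fst (@hl.1 (s, (f s).symm y) (s', (f s').symm y) (Prod.ext ?_ h))
      simp [hf]
    · intro s
      obtain ⟨⟨s', x⟩, h⟩ := hl.2 (y, s)
      obtain ⟨rfl, rfl⟩ := Prod.mk.inj h
      exact ⟨s', by simp [M', hf]⟩
  obtain ⟨A, hA⟩ := M.exists_isFreeAction ht
  obtain ⟨A', hA'⟩ := M'.exists_isFreeAction ht'
  refine ⟨fun s => ⟨A s, A' s, ?_, ?_⟩, hA⟩
  · exact hA.leftInverse hA' ht (fun s x => by simp [M', hf]) (fun s x => by simp [M', hf]) s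
  · exact hA'.leftInverse hA ht' (fun s x => by simp [M', hf]) (fun s x => by simp [M']) s

/-- If the states generate a separable subgroup of a group containing states and letters that obey
the relations of the automaton, and which acts suitably on the free group on the alphabet, then
the automaton generates a finite semigroup. -/
lemma Bireversible.finite_range_wordAct {S X G : Type} [Group G] [Finite X] {M : Mealy S X}
    (hb : M.Bireversible) {a : S → G} {b : X → G}
    (hrel : ∀ s x, a s * b x = b (M.o s x) * a (M.t s x))
    (hgen : Subgroup.closure (Set.range a ∪ Set.range b) = ⊤)
    (ψ : G →* Equiv.Perm (FreeGroup X)) (hψa : ∀ s, ψ (a s) 1 = 1)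
    (hψb : ∀ x g, ψ (b x) g = .of x * g)
    (hsep : (Subgroup.closure (Set.range a)).IsSeparable) : (Set.range M.wordAct).Finite := by
  set H := Subgroup.closure (Set.range a)
  have haH : ∀ s, a s ∈ H := fun s => Subgroup.subset_closure ⟨s, rfl⟩
  have horb : ∀ h ∈ H, ∀ c ∈ Set.range b ∪ Set.range fun x => (b x)⁻¹,
      ∃ d ∈ Set.range b ∪ Set.range fun x => (b x)⁻¹, d⁻¹ * (h * c) ∈ H := by
    intro h hh
    induction hh using Subgroup.closure_induction'' with
    | mem _ hs =>
      obtain ⟨s, rfl⟩ := hs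
      rintro _ (⟨x, rfl⟩ | ⟨x, rfl⟩)
      · refine ⟨b (M.o s x), .inl ⟨_, rfl⟩, ?_⟩
        rw [hrel, inv_mul_cancel_left]
        exact haH _
      · obtain ⟨s, rfl⟩ := (hb.2.1 x).2 s
        refine ⟨(b (M.o s x))⁻¹, .inr ⟨_, rfl⟩, ?_⟩
        simp only
        rw [inv_inv, ← mul_assoc, ← hrel, mul_inv_cancel_right]
        exact haH _
    | inv_mem _ hs =>
      obtain ⟨s, rfl⟩ := hs
      rintro _ (⟨y, rfl⟩ | ⟨y, rfl⟩)
      · obtain ⟨x, rfl⟩ := (hb.1 s).2 y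
        refine ⟨b x, .inl ⟨_, rfl⟩, ?_⟩
        rw [← mul_assoc, ← mul_inv_rev, hrel, mul_inv_rev, inv_mul_cancel_right]
        exact H.inv_mem (haH _)
      · obtain ⟨⟨s', x⟩, h⟩ := hb.2.2.2 (y, s)
        obtain ⟨rfl, rfl⟩ := Prod.mk.inj h
        refine ⟨(b x)⁻¹, .inr ⟨_, rfl⟩, ?_⟩
        simp only
        rw [inv_inv, ← mul_inv_rev, ← hrel, mul_inv_rev, mul_inv_cancel_left]
        exact H.inv_mem (haH _)
    | one => exact fun c hc => ⟨c, hc, by simp [H.one_mem]⟩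
    | mul h k _ _ ih ik =>
      intro c hc
      obtain ⟨d, hd, hdc⟩ := ik c hc
      obtain ⟨e, he, hed⟩ := ih d hd
      refine ⟨e, he, ?_⟩
      have := H.mul_mem hed hdc
      rwa [show e⁻¹ * (h * d) * (d⁻¹ * (k * c)) = e⁻¹ * (h * k * c) by group] at this
  obtain ⟨N, hN, hNH⟩ := hsep.exists_inf_le_normalCore
    ((Set.finite_range b).union (Set.finite_range fun x => (b x)⁻¹))
    (by rintro _ (⟨x, rfl⟩ | ⟨x, rfl⟩)
        · exact .inr ⟨x, rfl⟩
        · exact .inl ⟨x, (inv_inv _).symm⟩)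
    horb
    (top_le_iff.1 (hgen.ge.trans (Subgroup.closure_mono
      (Set.union_subset_union Subgroup.subset_closure Set.subset_union_left))))
  have hψH : ∀ h ∈ H, ψ h 1 = 1 := by
    intro h hh
    induction hh using Subgroup.closure_induction with
    | mem _ hs => obtain ⟨s, rfl⟩ := hs; exact hψa s
    | one => simp
    | mul h k _ _ ih ik => rw [map_mul, Equiv.Perm.mul_apply, ik, ih]
    | inv h _ ih => rw [map_inv, Equiv.Perm.inv_eq_iff_eq, ih]
  have hψw : ∀ w : List X, ψ (w.map b).prod 1 = (w.map FreeGroup.of).prod := by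
    intro w
    induction w with
    | nil => simp
    | cons x w ih => simp [hψb, ih]
  have hinj : ∀ w w' : List X, (w.map b).prod⁻¹ * (w'.map b).prod ∈ H → w = w' := by
    intro w w' h
    have h' := hψH _ h
    rw [map_mul, map_inv, Equiv.Perm.mul_apply, Equiv.Perm.inv_eq_iff_eq, hψw, hψw] at h'
    exact FreeGroup.injective_prod_map_of h'.symm
  have hact : ∀ s w, ∃ k ∈ H, a s * (w.map b).prod = ((M.actWord s w).map b).prod * k := by
    intro s w
    induction w generalizing s with
    | nil => exact ⟨a s, haH s, by simp [actWord]⟩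
    | cons x w ih =>
      obtain ⟨k, hk, h⟩ := ih (M.t s x)
      refine ⟨k, hk, ?_⟩
      simp only [List.map_cons, List.prod_cons, actWord]
      rw [← mul_assoc, hrel, mul_assoc, h, mul_assoc]
  let α : List S → G := fun u => (u.map a).reverse.prod
  have hαH : ∀ u, α u ∈ H := by
    intro u
    refine H.list_prod_mem fun g hg => ?_
    obtain ⟨s, -, rfl⟩ := List.mem_map.1 (List.mem_reverse.1 hg)
    exact haH s
  have hαact : ∀ u w, ∃ k ∈ H, α u * (w.map b).prod = ((M.wordAct u w).map b).prod * k := by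
    intro u
    induction u with
    | nil => exact fun w => ⟨1, H.one_mem, by simp [α, wordAct]⟩
    | cons s u ih =>
      intro w
      obtain ⟨k, hk, h⟩ := hact s w
      obtain ⟨l, hl, h'⟩ := ih (M.actWord s w)
      refine ⟨l * k, H.mul_mem hl hk, ?_⟩
      rw [show α (s :: u) = α u * a s by simp [α], mul_assoc, h, ← mul_assoc, h', mul_assoc]
      rfl
  have hcongr : ∀ u u' : List S, (α u : G ⧸ N) = α u' → M.wordAct u = M.wordAct u' := by
    intro u u' h
    funext w
    obtain ⟨k, hk, e⟩ := hαact u w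
    obtain ⟨k', hk', e'⟩ := hαact u' w
    have hn : (α u)⁻¹ * α u' ∈ N ⊓ H :=
      ⟨QuotientGroup.eq.1 h, H.mul_mem (H.inv_mem (hαH u)) (hαH u')⟩
    have hc := hNH hn (w.map b).prod⁻¹
    apply hinj
    have := H.mul_mem (H.mul_mem hk hc) (H.inv_mem hk')
    rw [eq_mul_inv_of_mul_eq e, eq_mul_inv_of_mul_eq e'] at this
    convert this using 1
    group
  have : Finite (G ⧸ N) := Subgroup.finite_quotient_of_finiteIndex
  let q : List S → G ⧸ N := fun u => α u
  refine Set.Finite.of_surjOn (s := Set.range q) (fun c => M.wordAct (Function.invFun q c)) ?_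
    (Set.toFinite _)
  rintro _ ⟨u, rfl⟩
  exact ⟨q u, ⟨u, rfl⟩, hcongr _ _ (Function.invFun_eq (f := q) ⟨u, rfl⟩)⟩

lemma genS_mul_genX {S X : Type} (M : Mealy S X) (s : S) (x : X) :
    M.genS s * M.genX x = M.genX (M.o s x) * M.genS (M.t s x) := by
  have h : (PresentedGroup.mk M.rels) (FreeGroup.of (Sum.inl s) * FreeGroup.of (Sum.inr x) *
      (FreeGroup.of (Sum.inl (M.t s x)))⁻¹ * (FreeGroup.of (Sum.inr (M.o s x)))⁻¹) = 1 :=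
    PresentedGroup.one_of_mem (Set.mem_iUnion₂.2 ⟨s, x, rfl⟩)
  rw [map_mul, map_mul, map_mul, map_inv, map_inv, mul_inv_eq_one, mul_inv_eq_iff_eq_mul] at h
  exact h

lemma closure_genS_union_genX {S X : Type} (M : Mealy S X) :
    Subgroup.closure (Set.range M.genS ∪ Set.range M.genX) = ⊤ := by
  rw [← PresentedGroup.closure_range_of M.rels]
  congr 1
  ext g
  simp [genS, genX]

lemma exists_hom {S X G : Type} [Group G] (M : Mealy S X) (a : S → G) (b : X → G)
    (hrel : ∀ s x, a s * b x = b (M.o s x) * a (M.t s x)) :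
    ∃ ψ : M.Pi1 →* G, (∀ s, ψ (M.genS s) = a s) ∧ ∀ x, ψ (M.genX x) = b x := by
  refine ⟨PresentedGroup.toGroup (f := Sum.elim a b) ?_,
    fun s => PresentedGroup.toGroup.of _, fun x => PresentedGroup.toGroup.of _⟩
  intro r hr
  obtain ⟨s, x, rfl⟩ := Set.mem_iUnion₂.1 hr
  simp [hrel]

lemma Bireversible.finite_autGroup_of_isSeparable_subS {S X : Type} [Finite X] {M : Mealy S X}
    (hb : M.Bireversible) (hsep : M.subS.IsSeparable) : Finite M.autGroup := by
  obtain ⟨A, hA⟩ := hb.exists_perm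
  obtain ⟨ψ, hψa, hψb⟩ := M.exists_hom A (fun x => Equiv.mulLeft (.of x)) fun s x =>
    Equiv.ext fun g => hA.of_mul s x g
  exact M.finite_autGroup <| hb.finite_range_wordAct M.genS_mul_genX M.closure_genS_union_genX ψ
    (fun s => by rw [hψa]; exact hA.one s) (fun x g => by rw [hψb]; rfl) hsep

lemma Bireversible.finite_autGroup_of_isSeparable_subX {S X : Type} [Finite S] [Finite X]
    {M : Mealy S X} (hb : M.Bireversible) (hsep : M.subX.IsSeparable) : Finite M.autGroup := by
  obtain ⟨A, hA⟩ := hb.dual.exists_perm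
  have hrel : ∀ s x, A x * Equiv.mulLeft (FreeGroup.of s) =
      Equiv.mulLeft (.of (M.t s x)) * A (M.o s x) :=
    fun s x => Equiv.ext fun g => hA.of_mul x s g
  obtain ⟨ψ, hψa, hψb⟩ := M.exists_hom (fun s => (Equiv.mulLeft (.of s))⁻¹) (fun x => (A x)⁻¹)
    fun s x => by rw [← mul_inv_rev, hrel, mul_inv_rev]
  have hinv : ∀ {ι : Type} (f : ι → M.Pi1), Set.range (fun i => (f i)⁻¹) = (Set.range f)⁻¹ :=
    fun f => by ext g; simp [inv_eq_iff_eq_inv]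
  refine M.finite_autGroup <| M.finite_range_wordAct_of_dual <|
    hb.dual.finite_range_wordAct (a := fun x => (M.genX x)⁻¹) (b := fun s => (M.genS s)⁻¹)
      (fun x s => ?_) ?_ ψ (fun x => ?_) (fun s g => ?_) ?_
  · rw [← mul_inv_rev, genS_mul_genX, mul_inv_rev]
    rfl
  · rw [hinv, hinv, ← Set.union_inv, Subgroup.closure_inv, Set.union_comm,
      closure_genS_union_genX]
  · rw [map_inv, hψb, inv_inv]
    exact hA.one x
  · rw [map_inv, hψa, inv_inv]
    rfl
  · rw [hinv, Subgroup.closure_inv]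
    exact hsep

end Mealy

open Mealy in
/-- If `G_A` is infinite then `π₁(Δ_A)` is not `⟨S⟩`-separable and not `⟨X⟩`-separable. -/
theorem infinite_autGroup_not_separable {S X : Type} [Finite S] [Finite X]
    [Nonempty S] [Nonempty X] (M : Mealy S X) (hb : M.Bireversible)
    (hinf : Infinite M.autGroup) :
    (∃ γ : M.Pi1, γ ∉ M.subS ∧
      ∀ H : Subgroup M.Pi1, H.FiniteIndex → M.subS ≤ H → γ ∈ H) ∧
    (∃ δ : M.Pi1, δ ∉ M.subX ∧
      ∀ H : Subgroup M.Pi1, H.FiniteIndex → M.subX ≤ H → δ ∈ H) := by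
  constructor
  · by_contra! h
    exact not_finite_iff_infinite.2 hinf (hb.finite_autGroup_of_isSeparable_subS h)
  · by_contra! h
    exact not_finite_iff_infinite.2 hinf (hb.finite_autGroup_of_isSeparable_subX h)
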